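/- For every real φ with 0 < φ < π/3, the convergent series ∑_{k=0}^∞ (C(3k,k)/27^k)·(4·cos²(3φ/2))^k·H_k equals (√3/sin(3φ/2))·[ cos(φ/2)·log( 2·cos²(φ/2 − π/3)/(√3·sin φ) ) + cos(φ/2 − π/3)·log( 2·cos²(φ/2)/(√3·sin(2π/3 − φ)) ) ]. -/

import Mathlib

open scoped BigOperators
open Real

/-- The `m`-th harmonic number `H_m = ∑_{j=1}^m 1/j`. -/
noncomputable def harmonicNum (m : ℕ) : ℝ := ∑ j ∈ Finset.range m, 1 / (j + 1 : ℝ)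

/-- The sum of the power series with coefficients `c`. -/
noncomputable def seriesSum (c : ℕ → ℝ) (t : ℝ) : ℝ := ∑' k, c k * t ^ k

/-- Coefficients of the formal derivative. -/
def derivCoeff (c : ℕ → ℝ) (k : ℕ) : ℝ := (k + 1) * c (k + 1)

/-- Polynomially bounded coefficient sequences. -/
def PolyBounded (c : ℕ → ℝ) : Prop := ∃ (C : ℝ) (m : ℕ), 0 ≤ C ∧ ∀ k : ℕ, |c k| ≤ C * (k + 1) ^ m

lemma PolyBounded.derivCoeff {c : ℕ → ℝ} (hc : PolyBounded c) : PolyBounded (derivCoeff c) := by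
  obtain ⟨C, m, hC, h⟩ := hc
  refine ⟨C * 2 ^ m, m + 1, by positivity, fun k => ?_⟩
  have h1 := h (k + 1)
  push_cast at h1
  have h2 : ((k : ℝ) + 1 + 1) ^ m ≤ (2 * (k + 1)) ^ m := by
    gcongr
    linarith [(Nat.cast_nonneg k : (0 : ℝ) ≤ k)]
  rw [_root_.derivCoeff, abs_mul, abs_of_nonneg (by positivity : (0 : ℝ) ≤ k + 1)]
  calc ((k : ℝ) + 1) * |c (k + 1)| ≤ (k + 1) * (C * (2 * (k + 1)) ^ m) := by
        gcongr
        exact h1.trans (by gcongr)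
    _ = C * 2 ^ m * (k + 1) ^ (m + 1) := by rw [mul_pow]; ring

lemma PolyBounded.natCast_mul {c : ℕ → ℝ} (hc : PolyBounded c) :
    PolyBounded (fun k => k * c k) := by
  obtain ⟨C, m, hC, h⟩ := hc
  refine ⟨C, m + 1, hC, fun k => ?_⟩
  rw [abs_mul, abs_of_nonneg (Nat.cast_nonneg k : (0 : ℝ) ≤ k)]
  calc (k : ℝ) * |c k| ≤ (k + 1) * (C * (k + 1) ^ m) := by
        gcongr
        · linarith
        · exact h k
    _ = C * (k + 1) ^ (m + 1) := by ring

lemma summable_succ_pow_mul_geometric (m : ℕ) {r : ℝ} (h0 : 0 ≤ r) (h1 : r < 1) :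
    Summable fun k : ℕ => ((k : ℝ) + 1) ^ m * r ^ k := by
  rcases h0.eq_or_lt with rfl | hr
  · exact summable_of_ne_finset_zero (s := {0}) fun k hk => by
      simp [zero_pow (by simpa using hk : k ≠ 0)]
  have h := (summable_nat_add_iff 1).2 (summable_pow_mul_geometric_of_norm_lt_one m
    (r := r) (by rwa [Real.norm_of_nonneg h0]))
  refine (h.mul_left r⁻¹).congr fun k => ?_
  push_cast
  rw [pow_succ]
  field_simp

lemma PolyBounded.summable {c : ℕ → ℝ} (hc : PolyBounded c) {t : ℝ} (ht : |t| < 1) :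
    Summable fun k => c k * t ^ k := by
  obtain ⟨C, m, hC, h⟩ := hc
  refine Summable.of_norm_bounded
    ((summable_succ_pow_mul_geometric m (abs_nonneg t) ht).mul_left C) fun k => ?_
  rw [norm_mul, norm_pow, Real.norm_eq_abs, Real.norm_eq_abs, ← mul_assoc]
  gcongr
  exact h k

lemma PolyBounded.hasSum {c : ℕ → ℝ} (hc : PolyBounded c) {t : ℝ} (ht : |t| < 1) :
    HasSum (fun k => c k * t ^ k) (seriesSum c t) :=
  (hc.summable ht).hasSum

lemma mul_seriesSum_succ {d : ℕ → ℝ} {t : ℝ} (h0 : d 0 = 0)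
    (hd : Summable fun k => d k * t ^ k) :
    t * seriesSum (fun k => d (k + 1)) t = seriesSum d t := by
  rw [seriesSum, seriesSum, hd.tsum_eq_zero_add, h0, zero_mul, zero_add, ← tsum_mul_left]
  exact tsum_congr fun k => by ring

lemma PolyBounded.mul_deriv {c : ℕ → ℝ} (hc : PolyBounded c) {t : ℝ} (ht : |t| < 1) :
    t * seriesSum (_root_.derivCoeff c) t = seriesSum (fun k => k * c k) t := by
  rw [← mul_seriesSum_succ (by simp) (hc.natCast_mul.summable ht)]
  congr 2
  ext k
  simp [_root_.derivCoeff]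

lemma PolyBounded.hasDerivAt {c : ℕ → ℝ} (hc : PolyBounded c) {t : ℝ} (ht : |t| < 1) :
    HasDerivAt (seriesSum c) (seriesSum (_root_.derivCoeff c) t) t := by
  obtain ⟨r, htr, hr⟩ := exists_between ht
  have hr0 : 0 < r := (abs_nonneg t).trans_lt htr
  have hderiv := hc.derivCoeff
  have hkey : HasDerivAt (fun z => ∑' k, c k * z ^ k)
      (∑' k, c k * (k * t ^ (k - 1))) t := by
    obtain ⟨C, m, hC, h⟩ := hc.natCast_mul
    refine hasDerivAt_tsum_of_isPreconnected
      (u := fun k : ℕ => r⁻¹ * (C * ((k + 1) ^ m * r ^ k)))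
      (t := Metric.ball 0 r) (y₀ := 0) ?_ Metric.isOpen_ball
      (convex_ball _ _).isPreconnected
      (fun k y _ => (hasDerivAt_pow k y).const_mul (c k)) ?_ (by simpa using hr0) ?_ ?_
    · exact ((summable_succ_pow_mul_geometric m hr0.le hr).mul_left C).mul_left r⁻¹
    · intro k y hy
      have hy' : |y| < r := by simpa using hy
      rcases k with _ | k
      · simp; positivity
      have h1 := h (k + 1)
      calc ‖c (k + 1) * (((k + 1 : ℕ) : ℝ) * y ^ (k + 1 - 1))‖
          = |((k + 1 : ℕ) : ℝ) * c (k + 1)| * |y| ^ k := by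
            rw [Real.norm_eq_abs, ← abs_pow, ← abs_mul, Nat.add_sub_cancel]
            congr 1
            ring
        _ ≤ (C * (((k + 1 : ℕ) : ℝ) + 1) ^ m) * r ^ k := by gcongr
        _ = r⁻¹ * (C * ((((k + 1 : ℕ) : ℝ) + 1) ^ m * r ^ (k + 1))) := by
            rw [pow_succ]
            field_simp
    · exact hc.summable (by simp)
    · simpa using htr
  have hs : Summable fun k : ℕ => c k * (k * t ^ (k - 1)) := by
    rw [← summable_nat_add_iff 1]
    refine (hderiv.summable ht).congr fun k => ?_
    simp [_root_.derivCoeff]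
    ring
  refine hkey.congr_deriv ?_
  rw [hs.tsum_eq_zero_add, seriesSum]
  simp only [Nat.cast_zero, zero_mul, mul_zero, zero_add]
  exact tsum_congr fun k => by simp [_root_.derivCoeff]; ring

/-- A coefficient recurrence turned into an inhomogeneous hypergeometric equation. -/
lemma PolyBounded.hypergeometric_ode {c e : ℕ → ℝ} (hc : PolyBounded c) {t : ℝ} (ht : |t| < 1)
    (hrec : ∀ k : ℕ, (k + 1) * (k + 1 / 2) * c (k + 1) - (k + 1 / 3) * (k + 2 / 3) * c k = e k) :
    t * (1 - t) * seriesSum (_root_.derivCoeff (_root_.derivCoeff c)) t +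
      (1 / 2 - 2 * t) * seriesSum (_root_.derivCoeff c) t - 2 / 9 * seriesSum c t =
      seriesSum e t := by
  have e1 := hc.mul_deriv ht
  have e2 := hc.derivCoeff.mul_deriv ht
  have e3 := hc.natCast_mul.mul_deriv ht
  have e4 : seriesSum (_root_.derivCoeff fun k => k * c k) t =
      t * seriesSum (_root_.derivCoeff (_root_.derivCoeff c)) t +
        seriesSum (_root_.derivCoeff c) t := by
    rw [e2]
    refine HasSum.unique (hc.natCast_mul.derivCoeff.hasSum ht) ?_
    convert! (hc.derivCoeff.natCast_mul.hasSum ht).add (hc.derivCoeff.hasSum ht) using 2 with k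
    simp [_root_.derivCoeff]
    ring
  have hsum : HasSum (fun k => e k * t ^ k)
      (seriesSum (fun k => k * _root_.derivCoeff c k) t +
        1 / 2 * seriesSum (_root_.derivCoeff c) t -
        seriesSum (fun k => k * (k * c k)) t - seriesSum (fun k => k * c k) t -
        2 / 9 * seriesSum c t) := by
    convert! ((((hc.derivCoeff.natCast_mul.hasSum ht).add
      ((hc.derivCoeff.hasSum ht).mul_left (1 / 2))).sub
      (hc.natCast_mul.natCast_mul.hasSum ht)).sub (hc.natCast_mul.hasSum ht)).sub
      ((hc.hasSum ht).mul_left (2 / 9)) using 2 with k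
    rw [← hrec k]
    simp only [_root_.derivCoeff]
    ring
  rw [show seriesSum e t = _ from hsum.tsum_eq, ← e3, ← e2, ← e1, e4]
  ring

/-- Substituting `t = sin² z` and multiplying by `cos z`. -/
lemma PolyBounded.hasDerivAt_cos_mul {c : ℕ → ℝ} (hc : PolyBounded c) {z : ℝ}
    (hz : 0 < cos z) :
    HasDerivAt (fun z => cos z * seriesSum c (sin z ^ 2))
      (-sin z * seriesSum c (sin z ^ 2) +
        2 * sin z * cos z ^ 2 * seriesSum (_root_.derivCoeff c) (sin z ^ 2)) z := by
  have ht : |sin z ^ 2| < 1 := by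
    rw [abs_of_nonneg (sq_nonneg _)]; nlinarith [sin_sq_add_cos_sq z]
  have h := (hasDerivAt_cos z).mul
    ((hc.hasDerivAt ht).comp z ((hasDerivAt_sin z).pow 2))
  convert! h using 1
  simp
  ring

lemma PolyBounded.hasDerivAt_cos_mul_deriv {c e : ℕ → ℝ} (hc : PolyBounded c) {z : ℝ}
    (hz : 0 < cos z)
    (hrec : ∀ k : ℕ, (k + 1) * (k + 1 / 2) * c (k + 1) - (k + 1 / 3) * (k + 2 / 3) * c k = e k) :
    HasDerivAt (fun z => -sin z * seriesSum c (sin z ^ 2) +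
        2 * sin z * cos z ^ 2 * seriesSum (_root_.derivCoeff c) (sin z ^ 2))
      (4 * cos z * seriesSum e (sin z ^ 2) - 1 / 9 * (cos z * seriesSum c (sin z ^ 2))) z := by
  have ht : |sin z ^ 2| < 1 := by
    rw [abs_of_nonneg (sq_nonneg _)]; nlinarith [sin_sq_add_cos_sq z]
  have hsq := (hasDerivAt_sin z).pow 2
  have h := ((hasDerivAt_sin z).neg.mul ((hc.hasDerivAt ht).comp z hsq)).add
    ((((hasDerivAt_sin z).const_mul 2).mul ((hasDerivAt_cos z).pow 2)).mul
      ((hc.derivCoeff.hasDerivAt ht).comp z hsq))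
  convert! h using 1
  rw [← hc.hypergeometric_ode ht hrec]
  simp
  generalize seriesSum (_root_.derivCoeff (_root_.derivCoeff c)) (sin z ^ 2) = p2
  generalize seriesSum (_root_.derivCoeff c) (sin z ^ 2) = p1
  generalize seriesSum c (sin z ^ 2) = p0
  linear_combination (-4 * cos z * sin z ^ 2 * p2 - 2 * cos z * p1) * sin_sq_add_cos_sq z

/-- A solution of the harmonic oscillator of frequency 1/3 with zero initial data vanishes. -/
lemma harmonic_oscillator_eq_zero {E E' E'' : ℝ → ℝ} {z : ℝ} (hz : 0 < z)
    (h1 : ∀ x ∈ Set.Icc 0 z, HasDerivAt E (E' x) x)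
    (h2 : ∀ x ∈ Set.Icc 0 z, HasDerivAt E' (E'' x) x)
    (hE : ∀ x ∈ Set.Ioo 0 z, E'' x + 1 / 9 * E x = 0) (h0 : E 0 = 0) (h0' : E' 0 = 0) :
    E z = 0 ∧ E' z = 0 := by
  have hd : ∀ x ∈ Set.Icc 0 z, HasDerivAt (fun x => E' x ^ 2 + 1 / 9 * E x ^ 2)
      (2 * E' x * (E'' x + 1 / 9 * E x)) x := by
    intro x hx
    convert! ((h2 x hx).pow 2).add (((h1 x hx).pow 2).const_mul (1 / 9)) using 1
    simp
    ring
  obtain ⟨x, hx, hx'⟩ := exists_hasDerivAt_eq_slope _ _ hz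
    (fun x hx => (hd x hx).continuousAt.continuousWithinAt)
    (fun x hx => hd x (Set.Ioo_subset_Icc_self hx))
  rw [hE x hx, mul_zero, eq_comm, div_eq_zero_iff, h0, h0'] at hx'
  have h3 : E' z ^ 2 + 1 / 9 * E z ^ 2 = 0 := by
    rcases hx' with h | h <;> linarith
  constructor <;> nlinarith [sq_nonneg (E' z), sq_nonneg (E z)]

/-- The coefficients `C(3k,k) (4/27)^k`. -/
noncomputable def trinCoeff (k : ℕ) : ℝ := (Nat.choose (3 * k) k : ℝ) / 27 ^ k * 4 ^ k

lemma trinCoeff_succ (k : ℕ) :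
    (k + 1) * (k + 1 / 2) * trinCoeff (k + 1) = (k + 1 / 3) * (k + 2 / 3) * trinCoeff k := by
  have h1 := Nat.add_choose_mul_factorial_mul_factorial (2 * k) k
  have h2 := Nat.add_choose_mul_factorial_mul_factorial (2 * (k + 1)) (k + 1)
  rw [show 2 * k + k = 3 * k by ring] at h1
  rw [show 2 * (k + 1) + (k + 1) = 3 * k + 1 + 1 + 1 by ring,
    show 2 * (k + 1) = 2 * k + 1 + 1 by ring] at h2
  simp only [Nat.factorial_succ] at h2
  rw [← h1] at h2
  have h3 : ((2 * k).factorial : ℝ) ≠ 0 := by positivity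
  have h4 : (k.factorial : ℝ) ≠ 0 := by positivity
  have h2' : ((3 * k + 1 + 1 + 1).choose (k + 1) : ℝ) *
      ((2 * k + 1 + 1) * ((2 * k + 1) * (2 * k).factorial)) * ((k + 1) * k.factorial) =
      (3 * k + 1 + 1 + 1) * ((3 * k + 1 + 1) * ((3 * k + 1) *
        ((3 * k).choose k * (2 * k).factorial * k.factorial))) := by exact_mod_cast h2
  have h5 : ((3 * k + 1 + 1 + 1).choose (k + 1) : ℝ) * ((2 * k + 2) * (2 * k + 1)) * (k + 1) =
      (3 * k + 3) * (3 * k + 2) * (3 * k + 1) * (3 * k).choose k := by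
    apply mul_right_cancel₀ (mul_ne_zero h3 h4)
    linear_combination h2'
  have h6 : ((3 * k + 1 + 1 + 1).choose (k + 1) : ℝ) * (2 * (2 * k + 1)) * (k + 1) =
      3 * (3 * k + 2) * (3 * k + 1) * (3 * k).choose k := by
    have : ((k : ℝ) + 1) ≠ 0 := by positivity
    apply mul_right_cancel₀ this
    linear_combination h5
  rw [trinCoeff, trinCoeff, show 3 * (k + 1) = 3 * k + 1 + 1 + 1 by ring, pow_succ, pow_succ]
  field_simp
  linear_combination 18 * h6

lemma trinCoeff_nonneg (k : ℕ) : 0 ≤ trinCoeff k := by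
  rw [trinCoeff]; positivity

lemma trinCoeff_le_one (k : ℕ) : trinCoeff k ≤ 1 := by
  induction k with
  | zero => simp [trinCoeff]
  | succ k ih =>
    have h := trinCoeff_succ k
    have h0 := trinCoeff_nonneg k
    have hk : (0 : ℝ) ≤ k := Nat.cast_nonneg k
    by_contra! hlt
    have h1 : ((k : ℝ) + 1) * (k + 1 / 2) * 1 < (k + 1) * (k + 1 / 2) * trinCoeff (k + 1) := by
      gcongr
    have h2 : ((k : ℝ) + 1 / 3) * (k + 2 / 3) * trinCoeff k ≤ (k + 1 / 3) * (k + 2 / 3) * 1 := by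
      gcongr
    nlinarith

lemma polyBounded_trinCoeff : PolyBounded trinCoeff :=
  ⟨1, 0, zero_le_one, fun k => by
    rw [abs_of_nonneg (trinCoeff_nonneg k)]
    simpa using trinCoeff_le_one k⟩

lemma harmonicNum_succ (k : ℕ) : harmonicNum (k + 1) = harmonicNum k + 1 / (k + 1 : ℝ) := by
  rw [harmonicNum, Finset.sum_range_succ, harmonicNum]

lemma harmonicNum_nonneg (k : ℕ) : 0 ≤ harmonicNum k :=
  Finset.sum_nonneg fun _ _ => by positivity

lemma harmonicNum_le (k : ℕ) : harmonicNum k ≤ k := by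
  induction k with
  | zero => simp [harmonicNum]
  | succ k ih =>
    rw [harmonicNum_succ]
    push_cast
    have : 1 / ((k : ℝ) + 1) ≤ 1 := by
      rw [div_le_one (by positivity)]
      linarith [(Nat.cast_nonneg k : (0 : ℝ) ≤ k)]
    linarith

lemma polyBounded_trinCoeff_mul_harmonicNum :
    PolyBounded fun k => trinCoeff k * harmonicNum k := by
  refine ⟨1, 1, zero_le_one, fun k => ?_⟩
  rw [abs_of_nonneg (mul_nonneg (trinCoeff_nonneg k) (harmonicNum_nonneg k))]
  have := mul_le_mul (trinCoeff_le_one k) (harmonicNum_le k) (harmonicNum_nonneg k) zero_le_one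
  linarith

lemma trinCoeff_mul_harmonicNum_succ (k : ℕ) :
    (k + 1) * (k + 1 / 2) * (trinCoeff (k + 1) * harmonicNum (k + 1)) -
      (k + 1 / 3) * (k + 2 / 3) * (trinCoeff k * harmonicNum k) =
      (k + 1 / 2) * trinCoeff (k + 1) := by
  rw [harmonicNum_succ]
  have : ((k : ℝ) + 1) ≠ 0 := by positivity
  have h := trinCoeff_succ k
  field_simp at h ⊢
  linear_combination harmonicNum k * h

lemma cos_pos_of_mem {x z : ℝ} (hz : z < π / 2) (hx : x ∈ Set.Icc 0 z) : 0 < cos x :=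
  cos_pos_of_mem_Ioo ⟨by linarith [hx.1, pi_pos], by linarith [hx.2]⟩

lemma seriesSum_zero (c : ℕ → ℝ) : seriesSum c 0 = c 0 := by
  rw [seriesSum, tsum_eq_single 0 (fun k hk => by simp [hk])]
  simp

lemma trin_closed_form {z : ℝ} (hz : 0 < z) (hz' : z < π / 2) :
    cos z * seriesSum trinCoeff (sin z ^ 2) = cos (z / 3) ∧
    -sin z * seriesSum trinCoeff (sin z ^ 2) +
        2 * sin z * cos z ^ 2 * seriesSum (derivCoeff trinCoeff) (sin z ^ 2) =
      -sin (z / 3) / 3 := by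
  have hc1 (x : ℝ) : HasDerivAt (fun x => cos (x / 3)) (-sin (x / 3) / 3) x := by
    convert! ((hasDerivAt_id x).div_const 3).cos using 1
    simp; ring
  have hc2 (x : ℝ) : HasDerivAt (fun x => -sin (x / 3) / 3) (-cos (x / 3) / 9) x := by
    convert! (((hasDerivAt_id x).div_const 3).sin.neg.div_const 3) using 1
    simp; ring
  have hrec (k : ℕ) : (k + 1) * (k + 1 / 2) * trinCoeff (k + 1) -
      (k + 1 / 3) * (k + 2 / 3) * trinCoeff k = (fun _ => (0 : ℝ)) k := by
    linarith [trinCoeff_succ k]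
  have h := harmonic_oscillator_eq_zero hz
    (fun x hx => (polyBounded_trinCoeff.hasDerivAt_cos_mul (cos_pos_of_mem hz' hx)).sub (hc1 x))
    (fun x hx => (polyBounded_trinCoeff.hasDerivAt_cos_mul_deriv
      (cos_pos_of_mem hz' hx) hrec).sub (hc2 x))
    (fun x _ => by simp [seriesSum]; ring)
    (by simp [seriesSum_zero, trinCoeff]) (by simp)
  simp only [Pi.sub_apply] at h
  exact ⟨by linarith [h.1], by linarith [h.2]⟩

lemma sin_sq_mul_source {z : ℝ} (hz : 0 < z) (hz' : z < π / 2) :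
    sin z ^ 2 * seriesSum (fun k : ℕ => (k + 1 / 2) * trinCoeff (k + 1)) (sin z ^ 2) =
      sin z ^ 2 * seriesSum (derivCoeff trinCoeff) (sin z ^ 2) -
        1 / 2 * seriesSum trinCoeff (sin z ^ 2) + 1 / 2 := by
  have hcos := cos_pos_of_mem hz' ⟨hz.le, le_rfl⟩
  have ht : |sin z ^ 2| < 1 := by
    rw [abs_of_nonneg (sq_nonneg _)]; nlinarith [sin_sq_add_cos_sq z]
  have hb := polyBounded_trinCoeff
  have h1 := ((hb.natCast_mul.hasSum ht).sub ((hb.hasSum ht).mul_left (1 / 2)))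
  have h2 := h1.summable.tsum_eq_zero_add
  rw [h1.tsum_eq, ← hb.mul_deriv ht] at h2
  rw [h2, seriesSum, ← tsum_mul_left]
  simp [trinCoeff]
  refine tsum_congr fun k => ?_
  ring

lemma source_closed_form {z : ℝ} (hz : 0 < z) (hz' : z < π / 2) :
    4 * cos z * seriesSum (fun k : ℕ => (k + 1 / 2) * trinCoeff (k + 1)) (sin z ^ 2) =
      (2 * sin z * (-sin (z / 3) / 3 + sin z * cos (z / 3) / cos z) / cos z
        - 2 * cos (z / 3) + 2 * cos z) / sin z ^ 2 := by
  have hcos := cos_pos_of_mem hz' ⟨hz.le, le_rfl⟩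
  have hsin : 0 < sin z := sin_pos_of_pos_of_lt_pi hz (by linarith [pi_pos])
  obtain ⟨h1, h2⟩ := trin_closed_form hz hz'
  have h3 := sin_sq_mul_source hz hz'
  rw [eq_div_iff (by positivity), ← h1, ← h2]
  generalize seriesSum (fun k : ℕ => (k + 1 / 2) * trinCoeff (k + 1)) (sin z ^ 2) = q at *
  field_simp
  linear_combination 4 * cos z ^ 2 * h3

lemma rational_source_identity {A B : ℝ} (h : A ^ 2 - A * B + B ^ 2 = 3 / 4) (hA : A ≠ 0) (hB : B ≠ 0)
    (hm : 2 * B - A ≠ 0) (hn : 2 * A - B ≠ 0) (hAB : A + B ≠ 0) :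
    (-4 * ((2 * B - A) * (2 * A - B) / 3) / B + 2 * A - 2 * ((2 * B - A) ^ 2 / 3) / A
      - 4 * ((2 * B - A) * (2 * A - B) / 3) / A + 2 * B - 2 * ((2 * A - B) ^ 2 / 3) / B
      - 2 * A / B ^ 2 + A / ((2 * B - A) ^ 2 / 3) + 1 / A
      - 2 * B / A ^ 2 + B / ((2 * A - B) ^ 2 / 3) + 1 / B) / 9 =
    -2 / (3 * (4 * A * B) * (A + B) * (4 * ((2 * B - A) * (2 * A - B) / 3)))
      + 2 / ((A + B) * (4 * ((2 * B - A) * (2 * A - B) / 3)) ^ 2)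
      - 8 * ((A + B) / 3) / (4 * A * B) ^ 2 := by
  have hN : 4 / 3 * (A ^ 2 - A * B + B ^ 2) = 1 := by rw [h]; norm_num
  have key : (-4 * ((2 * B - A) * (2 * A - B) / 3) / B + 2 * A - 2 * ((2 * B - A) ^ 2 / 3) / A
      - 4 * ((2 * B - A) * (2 * A - B) / 3) / A + 2 * B - 2 * ((2 * A - B) ^ 2 / 3) / B
      + (4 / 3 * (A ^ 2 - A * B + B ^ 2)) * (- 2 * A / B ^ 2 + A / ((2 * B - A) ^ 2 / 3) + 1 / A
      - 2 * B / A ^ 2 + B / ((2 * A - B) ^ 2 / 3) + 1 / B)) / 9 =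
    (4 / 3 * (A ^ 2 - A * B + B ^ 2)) ^ 3 *
      (-2 / (3 * (4 * A * B) * (A + B) * (4 * ((2 * B - A) * (2 * A - B) / 3)))
      + 2 / ((A + B) * (4 * ((2 * B - A) * (2 * A - B) / 3)) ^ 2))
      - (4 / 3 * (A ^ 2 - A * B + B ^ 2)) ^ 2 * (8 * ((A + B) / 3) / (4 * A * B) ^ 2) := by
    field_simp
    ring
  rw [hN] at key
  linear_combination key

lemma trig_source_identity {A B M P r c s S D : ℝ} (hr : r ^ 2 = 3)
    (h : A ^ 2 - A * B + B ^ 2 = 3 / 4) (hA : A ≠ 0) (hB : B ≠ 0) (hM : M ≠ 0) (hP : P ≠ 0)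
    (hAB : A + B ≠ 0) (hs : s ≠ 0) (eM : M = r * (2 * B - A) / 3) (eP : P = r * (2 * A - B) / 3)
    (ec : c = r * (A + B) / 3) (es : s = A - B) (eS : S = s * (4 * A * B))
    (eD : D = c * (4 * M * P)) :
    r / 9 * (2 * M * (-2 * P / B + A / M - M / A) - 2 * P * (2 * M / A - B / P + P / B)
      + A * (-2 / B ^ 2 + 1 / M ^ 2 + 1 / A ^ 2) + B * (-2 / A ^ 2 + 1 / P ^ 2 + 1 / B ^ 2)) =
    (2 * S * (-s / 3 + S * c / D) / D - 2 * c + 2 * D) / S ^ 2 := by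
  have hr0 : r ≠ 0 := by rintro rfl; norm_num at hr
  have hm : 2 * B - A ≠ 0 := by rintro h0; simp [eM, h0] at hM
  have hn : 2 * A - B ≠ 0 := by rintro h0; simp [eP, h0] at hP
  have key := rational_source_identity h hA hB hm hn hAB
  have hMP : M * P = (2 * B - A) * (2 * A - B) / 3 := by
    rw [eM, eP]; linear_combination (2 * B - A) * (2 * A - B) / 9 * hr
  have hM2 : M ^ 2 = (2 * B - A) ^ 2 / 3 := by
    rw [eM]; linear_combination (2 * B - A) ^ 2 / 9 * hr
  have hP2 : P ^ 2 = (2 * A - B) ^ 2 / 3 := by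
    rw [eP]; linear_combination (2 * A - B) ^ 2 / 9 * hr
  rw [← hMP, ← hM2, ← hP2] at key
  have hq : 4 * (M * P) = 1 - 4 * s ^ 2 := by
    rw [hMP, es]; linear_combination 4 / 3 * h
  have hc : c ≠ 0 := by
    rw [ec]; positivity
  have e1 : (2 * S * (-s / 3 + S * c / D) / D - 2 * c + 2 * D) / S ^ 2 =
      -2 / (3 * (4 * A * B) * c * (4 * (M * P))) + 2 / (c * (4 * (M * P)) ^ 2) -
        8 * c / (4 * A * B) ^ 2 := by
    have e2 : 2 * D - 2 * c = -8 * c * s ^ 2 := by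
      rw [eD]; linear_combination 2 * c * hq
    rw [show 2 * S * (-s / 3 + S * c / D) / D - 2 * c + 2 * D =
      2 * S * (-s / 3 + S * c / D) / D + (2 * D - 2 * c) by ring, e2, eD, eS]
    field_simp
    ring
  have e3 : -2 / (3 * (4 * A * B) * c * (4 * (M * P))) + 2 / (c * (4 * (M * P)) ^ 2) -
        8 * c / (4 * A * B) ^ 2 =
      r * (-2 / (3 * (4 * A * B) * (A + B) * (4 * (M * P)))
      + 2 / ((A + B) * (4 * (M * P)) ^ 2) - 8 * ((A + B) / 3) / (4 * A * B) ^ 2) := by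
    have e4 : 1 / c = r / (A + B) := by
      rw [div_eq_div_iff hc hAB, ec]; linear_combination (-(A + B) / 3) * hr
    have e5 : -2 / (3 * (4 * A * B) * c * (4 * (M * P))) + 2 / (c * (4 * (M * P)) ^ 2) =
      (1 / c) * (-2 / (3 * (4 * A * B) * (4 * (M * P))) + 2 / (4 * (M * P)) ^ 2) := by
      field_simp
    rw [e5, e4, ec]
    field_simp
  rw [e1, e3, ← key]
  field_simp
  ring

/-- The right-hand side of the evaluation, multiplied by `cos z` where `φ = π / 3 - 2 z / 3`. -/
noncomputable def logForm (A B M P : ℝ) : ℝ :=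
  √3 * (A * (2 * log B - log M - log A - log √3) + B * (2 * log A - log P - log B - log √3))

/-- The derivative of `logForm` in `z` when `A = cos (π/6 - z/3)`, `B = cos (π/6 + z/3)`,
`M = sin (π/6 - z/3)`, `P = sin (π/6 + z/3)`. -/
noncomputable def logFormDeriv (A B M P : ℝ) : ℝ :=
  √3 / 3 * (M * (2 * log B - log M - log A - log √3) - P * (2 * log A - log P - log B - log √3)
    + A * (-2 * P / B + A / M - M / A) + B * (2 * M / A - B / P + P / B))

lemma hasDerivAt_logForm {A B M P : ℝ → ℝ} {z : ℝ} (hA : HasDerivAt A (M z / 3) z)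
    (hB : HasDerivAt B (-P z / 3) z) (hM : HasDerivAt M (-A z / 3) z)
    (hP : HasDerivAt P (B z / 3) z) (hA0 : A z ≠ 0) (hB0 : B z ≠ 0) (hM0 : M z ≠ 0)
    (hP0 : P z ≠ 0) :
    HasDerivAt (fun z => logForm (A z) (B z) (M z) (P z))
      (logFormDeriv (A z) (B z) (M z) (P z)) z := by
  have h1 := (((hB.log hB0).const_mul 2).sub (hM.log hM0)).sub (hA.log hA0) |>.sub_const (log √3)
  have h2 := (((hA.log hA0).const_mul 2).sub (hP.log hP0)).sub (hB.log hB0) |>.sub_const (log √3)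
  refine (((hA.mul h1).add (hB.mul h2)).const_mul √3).congr_deriv ?_
  simp only [logFormDeriv, Pi.sub_apply]
  field_simp
  ring

lemma hasDerivAt_logFormDeriv {A B M P : ℝ → ℝ} {z : ℝ} (hA : HasDerivAt A (M z / 3) z)
    (hB : HasDerivAt B (-P z / 3) z) (hM : HasDerivAt M (-A z / 3) z)
    (hP : HasDerivAt P (B z / 3) z) (hA0 : A z ≠ 0) (hB0 : B z ≠ 0) (hM0 : M z ≠ 0)
    (hP0 : P z ≠ 0) (hAM : M z ^ 2 + A z ^ 2 = 1) (hBP : P z ^ 2 + B z ^ 2 = 1) :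
    HasDerivAt (fun z => logFormDeriv (A z) (B z) (M z) (P z))
      (√3 / 9 * (2 * M z * (-2 * P z / B z + A z / M z - M z / A z)
        - 2 * P z * (2 * M z / A z - B z / P z + P z / B z)
        + A z * (-2 / B z ^ 2 + 1 / M z ^ 2 + 1 / A z ^ 2)
        + B z * (-2 / A z ^ 2 + 1 / P z ^ 2 + 1 / B z ^ 2))
        - 1 / 9 * logForm (A z) (B z) (M z) (P z)) z := by
  have h1 := (((hB.log hB0).const_mul 2).sub (hM.log hM0)).sub (hA.log hA0) |>.sub_const (log √3)
  have h2 := (((hA.log hA0).const_mul 2).sub (hP.log hP0)).sub (hB.log hB0) |>.sub_const (log √3)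
  have h3 : HasDerivAt (fun z => -2 * P z / B z + A z / M z - M z / A z)
      ((-2 / B z ^ 2 + 1 / M z ^ 2 + 1 / A z ^ 2) / 3) z := by
    refine ((((hP.const_mul (-2)).fun_div hB hB0).add (hA.fun_div hM hM0)).sub
      (hM.fun_div hA hA0)).congr_deriv ?_
    rw [show -2 / B z ^ 2 = -2 * (P z ^ 2 + B z ^ 2) / B z ^ 2 by rw [hBP]; ring,
      show 1 / M z ^ 2 = (M z ^ 2 + A z ^ 2) / M z ^ 2 by rw [hAM],
      show 1 / A z ^ 2 = (M z ^ 2 + A z ^ 2) / A z ^ 2 by rw [hAM]]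
    ring
  have h4 : HasDerivAt (fun z => 2 * M z / A z - B z / P z + P z / B z)
      ((-2 / A z ^ 2 + 1 / P z ^ 2 + 1 / B z ^ 2) / 3) z := by
    refine ((((hM.const_mul 2).fun_div hA hA0).sub (hB.fun_div hP hP0)).add
      (hP.fun_div hB hB0)).congr_deriv ?_
    rw [show -2 / A z ^ 2 = -2 * (M z ^ 2 + A z ^ 2) / A z ^ 2 by rw [hAM]; ring,
      show 1 / P z ^ 2 = (P z ^ 2 + B z ^ 2) / P z ^ 2 by rw [hBP],
      show 1 / B z ^ 2 = (P z ^ 2 + B z ^ 2) / B z ^ 2 by rw [hBP]]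
    ring
  refine (((((hM.mul h1).sub (hP.mul h2)).add (hA.mul h3)).add (hB.mul h4)).const_mul
    (√3 / 3)).congr_deriv ?_
  simp only [logForm, Pi.sub_apply]
  ring

/-- The harmonic series with `t = sin² z`, multiplied by `cos z`. -/
lemma cos_mul_harmonic_series {z : ℝ} (hz : 0 < z) (hz' : z < π / 2) :
    cos z * seriesSum (fun k => trinCoeff k * harmonicNum k) (sin z ^ 2) =
      logForm (cos (π / 6 - z / 3)) (cos (π / 6 + z / 3)) (sin (π / 6 - z / 3))
        (sin (π / 6 + z / 3)) := by
  have hm (x : ℝ) : HasDerivAt (fun x : ℝ => π / 6 - x / 3) (-(1 / 3)) x :=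
    ((hasDerivAt_id x).div_const 3).const_sub (π / 6)
  have hp (x : ℝ) : HasDerivAt (fun x : ℝ => π / 6 + x / 3) (1 / 3) x :=
    ((hasDerivAt_id x).div_const 3).const_add (π / 6)
  have hA (x : ℝ) : HasDerivAt (fun x : ℝ => cos (π / 6 - x / 3)) (sin (π / 6 - x / 3) / 3) x :=
    (hm x).cos.congr_deriv (by ring)
  have hB (x : ℝ) : HasDerivAt (fun x : ℝ => cos (π / 6 + x / 3)) (-sin (π / 6 + x / 3) / 3) x :=
    (hp x).cos.congr_deriv (by ring)
  have hM (x : ℝ) : HasDerivAt (fun x : ℝ => sin (π / 6 - x / 3)) (-cos (π / 6 - x / 3) / 3) x :=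
    (hm x).sin.congr_deriv (by ring)
  have hP (x : ℝ) : HasDerivAt (fun x : ℝ => sin (π / 6 + x / 3)) (cos (π / 6 + x / 3) / 3) x :=
    (hp x).sin.congr_deriv (by ring)
  have hpi := pi_pos
  have hpos {x : ℝ} (hx : x ∈ Set.Icc 0 z) : 0 < cos (π / 6 - x / 3) ∧ 0 < cos (π / 6 + x / 3) ∧
      0 < sin (π / 6 - x / 3) ∧ 0 < sin (π / 6 + x / 3) := by
    obtain ⟨hx0, hx1⟩ := hx
    exact ⟨cos_pos_of_mem_Ioo ⟨by linarith, by linarith⟩,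
      cos_pos_of_mem_Ioo ⟨by linarith, by linarith⟩,
      sin_pos_of_pos_of_lt_pi (by linarith) (by linarith),
      sin_pos_of_pos_of_lt_pi (by linarith) (by linarith)⟩
  have hb := polyBounded_trinCoeff_mul_harmonicNum
  have hs3 : (√3) ^ 2 = 3 := sq_sqrt (by norm_num)
  have hlog : 2 * log (√3 / 2) - log (1 / 2) - log (√3 / 2) - log √3 = 0 := by
    rw [log_div (by positivity) (by norm_num), log_div one_ne_zero two_ne_zero, log_one]
    ring
  have h := harmonic_oscillator_eq_zero hz
    (fun x hx => (hb.hasDerivAt_cos_mul (cos_pos_of_mem hz' hx)).sub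
      (hasDerivAt_logForm (hA x) (hB x) (hM x) (hP x) (hpos hx).1.ne' (hpos hx).2.1.ne'
        (hpos hx).2.2.1.ne' (hpos hx).2.2.2.ne'))
    (fun x hx => (hb.hasDerivAt_cos_mul_deriv (cos_pos_of_mem hz' hx)
      trinCoeff_mul_harmonicNum_succ).sub
      (hasDerivAt_logFormDeriv (hA x) (hB x) (hM x) (hP x) (hpos hx).1.ne' (hpos hx).2.1.ne'
        (hpos hx).2.2.1.ne' (hpos hx).2.2.2.ne' (sin_sq_add_cos_sq _) (sin_sq_add_cos_sq _)))
    (fun x hx => ?_) (by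
      simp [logForm, -one_div, hlog, seriesSum_zero, harmonicNum])
    (by
      simp only [sin_zero, zero_div, sub_zero, add_zero, sin_pi_div_six, cos_pi_div_six,
        logFormDeriv, hlog]
      ring)
  · exact sub_eq_zero.1 h.1
  have hx' := Set.Ioo_subset_Icc_self hx
  obtain ⟨pA, pB, pM, pP⟩ := hpos hx'
  have h3x : x = 3 * (x / 3) := by ring
  have hsx : 0 < sin (x / 3) :=
    sin_pos_of_pos_of_lt_pi (by linarith [hx.1]) (by linarith [hx.2])
  have hcs := sin_sq_add_cos_sq (x / 3)
  have eA : cos (π / 6 - x / 3) = √3 / 2 * cos (x / 3) + sin (x / 3) / 2 := by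
    rw [cos_sub, cos_pi_div_six, sin_pi_div_six]; ring
  have eB : cos (π / 6 + x / 3) = √3 / 2 * cos (x / 3) - sin (x / 3) / 2 := by
    rw [cos_add, cos_pi_div_six, sin_pi_div_six]; ring
  have eM : sin (π / 6 - x / 3) = cos (x / 3) / 2 - √3 / 2 * sin (x / 3) := by
    rw [sin_sub, cos_pi_div_six, sin_pi_div_six]; ring
  have eP : sin (π / 6 + x / 3) = cos (x / 3) / 2 + √3 / 2 * sin (x / 3) := by
    rw [sin_add, cos_pi_div_six, sin_pi_div_six]; ring
  have hsrc := source_closed_form hx.1 (hx.2.trans hz')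
  have hid := trig_source_identity (r := √3) (c := cos (x / 3)) (s := sin (x / 3))
    (S := sin x) (D := cos x) hs3
    (by rw [eA, eB]; linear_combination 3 / 4 * hcs + cos (x / 3) ^ 2 / 4 * hs3)
    pA.ne' pB.ne' pM.ne' pP.ne' (by positivity) hsx.ne'
    (by rw [eA, eB, eM]; linear_combination -cos (x / 3) / 6 * hs3)
    (by rw [eA, eB, eP]; linear_combination -cos (x / 3) / 6 * hs3)
    (by rw [eA, eB]; linear_combination -cos (x / 3) / 3 * hs3)
    (by rw [eA, eB]; ring)
    (by
      conv_lhs => rw [h3x, sin_three_mul]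
      rw [eA, eB]
      linear_combination -sin (x / 3) * cos (x / 3) ^ 2 * hs3 - 3 * sin (x / 3) * hcs)
    (by
      conv_lhs => rw [h3x, cos_three_mul]
      rw [eM, eP]
      linear_combination cos (x / 3) * sin (x / 3) ^ 2 * hs3 + 3 * cos (x / 3) * hcs)
  simp only [Pi.sub_apply]
  linear_combination hsrc - hid

theorem sun_3k_Hk_log (φ : ℝ) (h0 : 0 < φ) (h1 : φ < π / 3) :
    ∑' k : ℕ, ((Nat.choose (3 * k) k : ℝ) / 27 ^ k) * (4 * cos (3 * φ / 2) ^ 2) ^ k *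
        harmonicNum k =
      (Real.sqrt 3 / sin (3 * φ / 2)) *
        (cos (φ / 2) * Real.log (2 * cos (φ / 2 - π / 3) ^ 2 / (Real.sqrt 3 * sin φ)) +
          cos (φ / 2 - π / 3) *
            Real.log (2 * cos (φ / 2) ^ 2 / (Real.sqrt 3 * sin (2 * π / 3 - φ)))) := by
  have hpi := pi_pos
  have h := cos_mul_harmonic_series (z := π / 2 - 3 * φ / 2) (by linarith) (by linarith)
  rw [cos_pi_div_two_sub, sin_pi_div_two_sub,
    show π / 6 - (π / 2 - 3 * φ / 2) / 3 = φ / 2 by ring,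
    show π / 6 + (π / 2 - 3 * φ / 2) / 3 = -(φ / 2 - π / 3) by ring, cos_neg, sin_neg] at h
  have hS : 0 < sin (3 * φ / 2) := sin_pos_of_pos_of_lt_pi (by linarith) (by linarith)
  have hA : 0 < cos (φ / 2) := cos_pos_of_mem_Ioo ⟨by linarith, by linarith⟩
  have hB : 0 < cos (φ / 2 - π / 3) := cos_pos_of_mem_Ioo ⟨by linarith, by linarith⟩
  have hM : 0 < sin (φ / 2) := sin_pos_of_pos_of_lt_pi (by linarith) (by linarith)
  have hP : 0 < -sin (φ / 2 - π / 3) := by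
    rw [← sin_neg]
    exact sin_pos_of_pos_of_lt_pi (by linarith) (by linarith)
  have hlog {a b m : ℝ} (ha : 0 < a) (hb : 0 < b) (hm : 0 < m) :
      log (2 * b ^ 2 / (√3 * (2 * m * a))) = 2 * log b - log m - log a - log √3 := by
    rw [show 2 * b ^ 2 / (√3 * (2 * m * a)) = b ^ 2 / m / a / √3 by field_simp,
      log_div (by positivity) (by positivity), log_div (by positivity) (by positivity),
      log_div (by positivity) (by positivity), log_pow]
    norm_num
  have e1 : sin φ = 2 * sin (φ / 2) * cos (φ / 2) := by
    rw [← sin_two_mul]; ring_nf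
  have e2 : sin (2 * π / 3 - φ) = 2 * -sin (φ / 2 - π / 3) * cos (φ / 2 - π / 3) := by
    rw [← sin_neg, ← cos_neg (φ / 2 - π / 3), ← sin_two_mul]; ring_nf
  rw [e1, e2, hlog hA hB hM, hlog hB hA hP, div_mul_eq_mul_div, eq_div_iff hS.ne', mul_comm]
  refine Eq.trans ?_ h
  rw [seriesSum]
  congr 1
  refine tsum_congr fun k => ?_
  rw [trinCoeff, mul_pow]
  ring
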